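/- Let G be an FDES (the uncontrolled system) and R an FDES (the specification), both over the same finite event set E, and let Σuc : E → [0,1] be a degree-of-uncontrollability assignment. Then there exists a fuzzy Σuc-compatible FDES S over E (with some finite number of states) such that G || S ∼ R (fuzzy simulation equivalence) if and only if R ⊆ G and G || R⁺ ⊆ R. -/

import Mathlib

open unitInterval

/-- A fuzzy discrete event system (FDES) over event set `E` with crisp state
index type `S`: fuzzy initial state vector, fuzzy marked state vector, and an
`S × S` fuzzy event matrix for each event, with entries in `[0,1]`. -/
structure FDES (E : Type) (S : Type) where
  x0 : S → unitInterval
  xm : S → unitInterval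
  sig : E → S → S → unitInterval

/-- Max-min product of matrices over `[0,1]`. -/
noncomputable def maxmin {α β γ : Type} [Fintype β]
    (A : α → β → unitInterval) (B : β → γ → unitInterval) : α → γ → unitInterval :=
  fun i k => Finset.univ.sup fun j => A i j ⊓ B j k

/-- Max-min product of a (row) vector with a matrix. -/
noncomputable def vecMat {β γ : Type} [Fintype β]
    (x : β → unitInterval) (B : β → γ → unitInterval) : γ → unitInterval :=
  fun k => Finset.univ.sup fun j => x j ⊓ B j k

/-- `φ` is a fuzzy simulation from `G1` to `G2`:
(a) `x01 ≤ x02 ⊙ φᵀ`, (b) `xm1 ⊙ φ ≤ xm2`, (c) `φᵀ ⊙ σ1(e) ≤ σ2(e) ⊙ φᵀ` for all `e`. -/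
def IsFuzzySim {E S1 S2 : Type} [Fintype S1] [Fintype S2]
    (G1 : FDES E S1) (G2 : FDES E S2) (φ : S1 → S2 → unitInterval) : Prop :=
  (∀ i, G1.x0 i ≤ Finset.univ.sup fun j => G2.x0 j ⊓ φ i j) ∧
  (∀ j, (Finset.univ.sup fun i => G1.xm i ⊓ φ i j) ≤ G2.xm j) ∧
  (∀ e : E, ∀ j i, (Finset.univ.sup fun i' => φ i' j ⊓ G1.sig e i' i)
      ≤ Finset.univ.sup fun j' => G2.sig e j j' ⊓ φ i j')

/-- `G1 ⊆ G2`: some fuzzy simulation from `G1` to `G2` exists. -/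
def Sim {E S1 S2 : Type} [Fintype S1] [Fintype S2]
    (G1 : FDES E S1) (G2 : FDES E S2) : Prop :=
  ∃ φ, IsFuzzySim G1 G2 φ

/-- Fuzzy tensor of two matrices over `[0,1]`. -/
noncomputable def ftensor {α β γ δ : Type} (A : α → β → unitInterval) (B : γ → δ → unitInterval) :
    α × γ → β × δ → unitInterval :=
  fun p q => A p.1 q.1 ⊓ B p.2 q.2

/-- Parallel composition of two FDESs over the same event set. -/
noncomputable def par {E S1 S2 : Type} (G1 : FDES E S1) (G2 : FDES E S2) : FDES E (S1 × S2) where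
  x0 := fun p => G1.x0 p.1 ⊓ G2.x0 p.2
  xm := fun p => G1.xm p.1 ⊓ G2.xm p.2
  sig := fun e => ftensor (G1.sig e) (G2.sig e)

/-- The fuzzy state vector reached after executing the word `s`. -/
noncomputable def run {E S : Type} [Fintype S] (G : FDES E S) (s : List E) : S → unitInterval :=
  s.foldl (fun v e => vecMat v (G.sig e)) G.x0

/-- The fuzzy language generated by `G`. -/
noncomputable def lang {E S : Type} [Fintype S] (G : FDES E S) : List E → unitInterval
  | [] => 1
  | e :: s => Finset.univ.sup fun i => run G (e :: s) i

/-- `S` is fuzzy `Suc`-compatible: every row of every event matrix has an entry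
at least the degree of uncontrollability of that event. -/
def Compatible {E S : Type} [Fintype S] (G : FDES E S) (Suc : E → unitInterval) : Prop :=
  ∀ (e : E) (i : S), Suc e ≤ Finset.univ.sup fun j => G.sig e i j

/-- The augmented FDES `R⁺` obtained from `R` by adding one extra crisp state
(`none`), following Algorithm 1. -/
noncomputable def Rplus {E S : Type} [Fintype S] (R : FDES E S) (Suc : E → unitInterval) :
    FDES E (Option S) where
  x0 := fun s => match s with | some i => R.x0 i | none => 0
  xm := fun s => match s with | some i => R.xm i | none => 0
  sig := fun e p q => match p, q with
    | some i, some j => R.sig e i j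
    | none, some _ => 0
    | none, none => Suc e
    | some i, none =>
        if Suc e ≤ Finset.univ.sup (fun j => R.sig e i j) then 0 else Suc e

theorem le_univ_sup_iff {S : Type} [Fintype S] {f : S → unitInterval} {c : unitInterval}
    (hc : 0 < c) : c ≤ Finset.univ.sup f ↔ ∃ j, c ≤ f j := by
  rw [Finset.le_sup_iff hc]
  simp

/-- Comparison in the unit interval can be tested on positive lower bounds. -/
theorem unitInterval_le_of_forall_pos {a b : unitInterval}
    (h : ∀ c, 0 < c → c ≤ a → c ≤ b) : a ≤ b := by
  rcases eq_or_lt_of_le (unitInterval.nonneg' (t := a)) with ha | ha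
  · exact ha ▸ unitInterval.nonneg'
  · exact h a ha le_rfl

/-- A fuzzy simulation is a matrix all of whose positive cuts are simulations of the cuts. -/
theorem isFuzzySim_iff {E S1 S2 : Type} [Fintype S1] [Fintype S2]
    {G1 : FDES E S1} {G2 : FDES E S2} {φ : S1 → S2 → unitInterval} :
    IsFuzzySim G1 G2 φ ↔ ∀ c, 0 < c →
      (∀ i, c ≤ G1.x0 i → ∃ j, c ≤ G2.x0 j ∧ c ≤ φ i j) ∧
      (∀ i j, c ≤ G1.xm i → c ≤ φ i j → c ≤ G2.xm j) ∧
      (∀ e i' i j, c ≤ φ i' j → c ≤ G1.sig e i' i →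
        ∃ j', c ≤ G2.sig e j j' ∧ c ≤ φ i j') := by
  constructor
  · rintro ⟨h0, hm, hs⟩ c hc
    refine ⟨fun i hi => ?_, fun i j hi hj => ?_, fun e i' i j hj hi => ?_⟩
    · simpa only [le_univ_sup_iff hc, le_inf_iff] using hi.trans (h0 i)
    · exact ((le_univ_sup_iff hc).2 ⟨i, le_inf hi hj⟩).trans (hm j)
    · simpa only [le_univ_sup_iff hc, le_inf_iff] using
        ((le_univ_sup_iff hc).2 ⟨i', le_inf hj hi⟩).trans (hs e j i)
  · intro h
    refine ⟨fun i => ?_, fun j => ?_, fun e j i => ?_⟩ <;>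
      refine unitInterval_le_of_forall_pos fun c hc => ?_ <;>
      obtain ⟨h0, hm, hs⟩ := h c hc <;>
      simp only [le_univ_sup_iff hc, le_inf_iff]
    · exact h0 i
    · rintro ⟨i, hi, hj⟩
      exact hm i j hi hj
    · rintro ⟨i', hj, hi⟩
      exact hs e i' i j hj hi

/-- A map of states that does not decrease any of the data induces a fuzzy simulation. -/
theorem Sim.of_map {E S1 S2 : Type} [Fintype S1] [Fintype S2]
    {G1 : FDES E S1} {G2 : FDES E S2} (f : S1 → S2)
    (h0 : ∀ i, G1.x0 i ≤ G2.x0 (f i)) (hm : ∀ i, G1.xm i ≤ G2.xm (f i))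
    (hs : ∀ e i j, G1.sig e i j ≤ G2.sig e (f i) (f j)) : Sim G1 G2 := by
  classical
  refine ⟨fun i j => if f i = j then 1 else 0, isFuzzySim_iff.2 fun c hc => ?_⟩
  have key : ∀ i j, c ≤ (if f i = j then (1 : unitInterval) else 0) ↔ f i = j := by
    intro i j
    split_ifs with h
    · exact iff_of_true unitInterval.le_one' h
    · exact iff_of_false hc.not_ge h
  simp only [key]
  refine ⟨fun i hi => ⟨f i, hi.trans (h0 i), rfl⟩, ?_, ?_⟩
  · rintro i _ hi rfl
    exact hi.trans (hm i)
  · rintro e i' i _ rfl hi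
    exact ⟨f i, hi.trans (hs e i' i), rfl⟩

theorem Sim.trans {E S1 S2 S3 : Type} [Fintype S1] [Fintype S2] [Fintype S3]
    {G1 : FDES E S1} {G2 : FDES E S2} {G3 : FDES E S3} (h : Sim G1 G2) (h' : Sim G2 G3) :
    Sim G1 G3 := by
  obtain ⟨φ, hφ⟩ := h
  obtain ⟨ψ, hψ⟩ := h'
  rw [isFuzzySim_iff] at hφ hψ
  refine ⟨maxmin φ ψ, isFuzzySim_iff.2 fun c hc => ?_⟩
  obtain ⟨h0, hm, hs⟩ := hφ c hc
  obtain ⟨h0', hm', hs'⟩ := hψ c hc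
  simp only [maxmin, le_univ_sup_iff hc, le_inf_iff]
  refine ⟨fun i hi => ?_, ?_, ?_⟩
  · obtain ⟨j, hj, hij⟩ := h0 i hi
    obtain ⟨k, hk, hjk⟩ := h0' j hj
    exact ⟨k, hk, j, hij, hjk⟩
  · rintro i k hi ⟨j, hij, hjk⟩
    exact hm' j k (hm i j hi hij) hjk
  · rintro e i' i k ⟨j, hij, hjk⟩ hi
    obtain ⟨j', hj, hij'⟩ := hs e i' i j hij hi
    obtain ⟨k', hk, hjk'⟩ := hs' e j j' k hjk hj
    exact ⟨k', hk, j', hij', hjk'⟩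

theorem par_sim_left {E S1 S2 : Type} [Fintype S1] [Fintype S2]
    (G1 : FDES E S1) (G2 : FDES E S2) : Sim (par G1 G2) G1 :=
  .of_map Prod.fst (fun _ => inf_le_left) (fun _ => inf_le_left) (fun _ _ _ => inf_le_left)

theorem par_sim_right {E S1 S2 : Type} [Fintype S1] [Fintype S2]
    (G1 : FDES E S1) (G2 : FDES E S2) : Sim (par G1 G2) G2 :=
  .of_map Prod.snd (fun _ => inf_le_right) (fun _ => inf_le_right) (fun _ _ _ => inf_le_right)

theorem Sim.par {E S S1 S2 : Type} [Fintype S] [Fintype S1] [Fintype S2]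
    {G : FDES E S} {G1 : FDES E S1} {G2 : FDES E S2} (h : Sim G G1) (h' : Sim G G2) :
    Sim G (par G1 G2) := by
  obtain ⟨φ, hφ⟩ := h
  obtain ⟨ψ, hψ⟩ := h'
  rw [isFuzzySim_iff] at hφ hψ
  refine ⟨fun i p => φ i p.1 ⊓ ψ i p.2, isFuzzySim_iff.2 fun c hc => ?_⟩
  obtain ⟨h0, hm, hs⟩ := hφ c hc
  obtain ⟨h0', hm', hs'⟩ := hψ c hc
  simp only [_root_.par, ftensor, le_inf_iff]
  refine ⟨fun i hi => ?_, ?_, ?_⟩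
  · obtain ⟨j, hj, hij⟩ := h0 i hi
    obtain ⟨k, hk, hik⟩ := h0' i hi
    exact ⟨(j, k), ⟨hj, hk⟩, hij, hik⟩
  · rintro i ⟨j, k⟩ hi ⟨hij, hik⟩
    exact ⟨hm i j hi hij, hm' i k hi hik⟩
  · rintro e i' i ⟨j, k⟩ ⟨hij, hik⟩ hi
    obtain ⟨j', hj, hij'⟩ := hs e i' i j hij hi
    obtain ⟨k', hk, hik'⟩ := hs' e i' i k hik hi
    exact ⟨(j', k'), ⟨hj, hk⟩, hij', hik'⟩

theorem Sim.par_right {E S S1 S2 : Type} [Fintype S] [Fintype S1] [Fintype S2]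
    (G : FDES E S) {G1 : FDES E S1} {G2 : FDES E S2} (h : Sim G1 G2) :
    Sim (_root_.par G G1) (_root_.par G G2) :=
  (par_sim_left G G1).par ((par_sim_right G G1).trans h)

theorem sim_Rplus {E S : Type} [Fintype S] (R : FDES E S) (Suc : E → unitInterval) :
    Sim R (Rplus R Suc) :=
  .of_map some (fun _ => le_rfl) (fun _ => le_rfl) (fun _ _ _ => le_rfl)

theorem compatible_Rplus {E S : Type} [Fintype S] (R : FDES E S) (Suc : E → unitInterval) :
    Compatible (Rplus R Suc) Suc := by
  rintro e (_ | i)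
  · exact Finset.le_sup (f := fun j => (Rplus R Suc).sig e none j) (Finset.mem_univ none)
  · by_cases h : Suc e ≤ Finset.univ.sup fun j => R.sig e i j
    · exact h.trans (Finset.sup_le fun j _ =>
        Finset.le_sup (f := fun j => (Rplus R Suc).sig e (some i) j) (Finset.mem_univ (some j)))
    · refine le_trans ?_ (Finset.le_sup (f := fun j => (Rplus R Suc).sig e (some i) j)
        (Finset.mem_univ none))
      simp [Rplus, h]

/-- A compatible system simulating `R` also simulates the augmentation of `R`. -/
theorem Compatible.sim_of_sim {E S T : Type} [Fintype S] [Fintype T] {R : FDES E S}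
    {H : FDES E T} {Suc : E → unitInterval} (hH : Compatible H Suc) (h : Sim R H) :
    Sim (Rplus R Suc) H := by
  obtain ⟨φ, hφ⟩ := h
  rw [isFuzzySim_iff] at hφ
  refine ⟨fun i t => i.elim 1 (φ · t), isFuzzySim_iff.2 fun c hc => ?_⟩
  obtain ⟨h0, hm, hs⟩ := hφ c hc
  have hsink : ∀ e t, c ≤ Suc e → ∃ t', c ≤ H.sig e t t' ∧ c ≤ 1 := by
    intro e t he
    obtain ⟨t', ht⟩ := (le_univ_sup_iff hc).1 (he.trans (hH e t))
    exact ⟨t', ht, unitInterval.le_one'⟩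
  refine ⟨?_, ?_, ?_⟩
  · rintro (_ | i) hi
    · exact absurd hi hc.not_ge
    · exact h0 i hi
  · rintro (_ | i) t hi ht
    · exact absurd hi hc.not_ge
    · exact hm i t hi ht
  · rintro e (_ | i') (_ | i) t ht hi
    · exact hsink e t hi
    · exact absurd hi hc.not_ge
    · refine hsink e t (le_trans hi ?_)
      simp only [Rplus]
      split_ifs
      · exact unitInterval.nonneg'
      · exact le_rfl
    · exact hs e i' i t ht hi

/-- Relabel the states of a system along an equivalence. -/
def FDES.reindex {E S T : Type} (G : FDES E S) (f : T ≃ S) : FDES E T where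
  x0 := fun i => G.x0 (f i)
  xm := fun i => G.xm (f i)
  sig := fun e i j => G.sig e (f i) (f j)

theorem reindex_sim {E S T : Type} [Fintype S] [Fintype T] (G : FDES E S) (f : T ≃ S) :
    Sim (G.reindex f) G :=
  .of_map f (fun _ => le_rfl) (fun _ => le_rfl) (fun _ _ _ => le_rfl)

theorem sim_reindex {E S T : Type} [Fintype S] [Fintype T] (G : FDES E S) (f : T ≃ S) :
    Sim G (G.reindex f) :=
  .of_map f.symm (fun _ => by simp [FDES.reindex]) (fun _ => by simp [FDES.reindex])
    (fun _ _ _ => by simp [FDES.reindex])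

theorem Compatible.reindex {E S T : Type} [Fintype S] [Fintype T] {G : FDES E S}
    {Suc : E → unitInterval} (h : Compatible G Suc) (f : T ≃ S) :
    Compatible (G.reindex f) Suc := by
  intro e i
  refine (h e (f i)).trans (Finset.sup_le fun j _ => ?_)
  simpa [FDES.reindex] using
    Finset.le_sup (f := fun k => (G.reindex f).sig e i k) (Finset.mem_univ (f.symm j))

/-- there exists a fuzzy `Suc`-compatible supervisor `S` with
`G || S ∼ R` iff `R ⊆ G` and `G || R⁺ ⊆ R`. -/
theorem stmt_12 {E SG SR : Type} [Fintype E] [Fintype SG] [Fintype SR]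
    (G : FDES E SG) (R : FDES E SR) (Suc : E → unitInterval) :
    (∃ (n : ℕ) (S : FDES E (Fin n)), Compatible S Suc ∧
        Sim (par G S) R ∧ Sim R (par G S)) ↔
      (Sim R G ∧ Sim (par G (Rplus R Suc)) R) := by
  constructor
  · rintro ⟨n, S, hS, hGS, hR⟩
    exact ⟨hR.trans (par_sim_left G S),
      (Sim.par_right G (hS.sim_of_sim (hR.trans (par_sim_right G S)))).trans hGS⟩
  · rintro ⟨hRG, hGR⟩
    let f := (Fintype.equivFin (Option SR)).symm
    exact ⟨_, (Rplus R Suc).reindex f, (compatible_Rplus R Suc).reindex f,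
      (Sim.par_right G (reindex_sim _ f)).trans hGR,
      hRG.par ((sim_Rplus R Suc).trans (sim_reindex _ f))⟩
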